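/- arXiv:2306.02347 — 2 statements merged into one kernel-verified Lean document; each statement's English description precedes it below -/
import Mathlib

section
/- Let H be a separable real Hilbert space, ε > 0 and δ ≥ 0. Let D and D̂ be bounded positive (self-adjoint, nonnegative) operators on H with D̂ − D Hilbert–Schmidt and ‖D̂ − D‖₂ ≤ δ. Let R₀ be a Hilbert–Schmidt operator on H, set C₀ := D^{1/2} R₀ D^{1/2}, and let Ĉ₀ be a Hilbert–Schmidt operator with ‖Ĉ₀ − C₀‖₂ ≤ δ. Define R̂₀ := (εI + D̂)^{−1/2} Ĉ₀ (εI + D̂)^{−1/2} and R_{e,0} := (εI + D)^{−1/2} C₀ (εI + D)^{−1/2}. Then ‖R̂₀ − R_{e,0}‖₂ ≤ 2(1 + ‖R₀‖₂)( δ²/ε² + δ/ε ). -/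
section Helpers

set_option linter.unusedSectionVars false

variable {E : Type*} [NormedAddCommGroup E] [InnerProductSpace ℝ E] [CompleteSpace E]
  {ι : Type*}

theorem mulA_apply (A B : E →L[ℝ] E) (x : E) : (A * B) x = A (B x) := rfl

/-- `T` has Hilbert–Schmidt norm at most `c` (finite partial sums formulation). -/
def HSle (e : HilbertBasis ι ℝ E) (T : E →L[ℝ] E) (c : ℝ) : Prop :=
  0 ≤ c ∧ ∀ s : Finset ι, ∑ i ∈ s, ‖T (e i)‖ ^ 2 ≤ c ^ 2

theorem HSle.summable {e : HilbertBasis ι ℝ E} {T : E →L[ℝ] E} {c : ℝ} (h : HSle e T c) :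
    Summable fun i => ‖T (e i)‖ ^ 2 :=
  summable_of_sum_le (fun _ => by positivity) h.2

theorem HSle.tsum_le {e : HilbertBasis ι ℝ E} {T : E →L[ℝ] E} {c : ℝ} (h : HSle e T c) :
    ∑' i, ‖T (e i)‖ ^ 2 ≤ c ^ 2 :=
  h.summable.tsum_le_of_sum_le h.2

theorem HSle.sqrt_le {e : HilbertBasis ι ℝ E} {T : E →L[ℝ] E} {c : ℝ} (h : HSle e T c) :
    Real.sqrt (∑' i, ‖T (e i)‖ ^ 2) ≤ c :=
  (Real.sqrt_le_left h.1).2 h.tsum_le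

theorem HSle.of_sqrt {e : HilbertBasis ι ℝ E} {T : E →L[ℝ] E} {c : ℝ}
    (hs : Summable fun i => ‖T (e i)‖ ^ 2)
    (h : Real.sqrt (∑' i, ‖T (e i)‖ ^ 2) ≤ c) : HSle e T c := by
  have hc : 0 ≤ c := (Real.sqrt_nonneg _).trans h
  refine ⟨hc, fun s => ?_⟩
  refine (hs.sum_le_tsum s (fun _ _ => by positivity)).trans ?_
  exact (Real.sqrt_le_left hc).1 h

theorem HSle.mono {e : HilbertBasis ι ℝ E} {T : E →L[ℝ] E} {c d : ℝ} (h : HSle e T c)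
    (hcd : c ≤ d) : HSle e T d :=
  ⟨h.1.trans hcd, fun s => (h.2 s).trans (by have := h.1; gcongr)⟩

theorem HSle.add {e : HilbertBasis ι ℝ E} {T S : E →L[ℝ] E} {c d : ℝ} (h : HSle e T c)
    (h' : HSle e S d) : HSle e (T + S) (c + d) := by
  refine ⟨add_nonneg h.1 h'.1, fun s => ?_⟩
  have h1 := h.2 s
  have h2 := h'.2 s
  have hc := h.1
  have hd := h'.1
  have hcs := Finset.sum_mul_sq_le_sq_mul_sq s (fun i => ‖T (e i)‖) (fun i => ‖S (e i)‖)
  have h3 : ∑ i ∈ s, ‖T (e i)‖ * ‖S (e i)‖ ≤ c * d := by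
    apply le_of_sq_le_sq _ (mul_nonneg hc hd)
    refine hcs.trans ?_
    rw [mul_pow]
    exact mul_le_mul h1 h2 (Finset.sum_nonneg fun _ _ => by positivity) (by positivity)
  calc ∑ i ∈ s, ‖(T + S) (e i)‖ ^ 2
      ≤ ∑ i ∈ s, (‖T (e i)‖ ^ 2 + 2 * (‖T (e i)‖ * ‖S (e i)‖) + ‖S (e i)‖ ^ 2) := by
        refine Finset.sum_le_sum fun i _ => ?_
        have := norm_add_le (T (e i)) (S (e i))
        have h4 : ‖(T + S) (e i)‖ ^ 2 ≤ (‖T (e i)‖ + ‖S (e i)‖) ^ 2 := by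
          gcongr
          exact this
        linarith
    _ = ∑ i ∈ s, ‖T (e i)‖ ^ 2 + 2 * ∑ i ∈ s, ‖T (e i)‖ * ‖S (e i)‖
        + ∑ i ∈ s, ‖S (e i)‖ ^ 2 := by
        rw [Finset.sum_add_distrib, Finset.sum_add_distrib, Finset.mul_sum]
    _ ≤ (c + d) ^ 2 := by nlinarith

theorem HSle.mul_left {e : HilbertBasis ι ℝ E} {T : E →L[ℝ] E} {c a : ℝ} (h : HSle e T c)
    (A : E →L[ℝ] E) (hA : ‖A‖ ≤ a) : HSle e (A * T) (a * c) := by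
  have ha : 0 ≤ a := (norm_nonneg A).trans hA
  refine ⟨mul_nonneg ha h.1, fun s => ?_⟩
  calc ∑ i ∈ s, ‖(A * T) (e i)‖ ^ 2 ≤ ∑ i ∈ s, a ^ 2 * ‖T (e i)‖ ^ 2 := by
        refine Finset.sum_le_sum fun i _ => ?_
        rw [← mul_pow]
        gcongr
        exact (A.le_opNorm (T (e i))).trans (mul_le_mul_of_nonneg_right hA (norm_nonneg _))
    _ = a ^ 2 * ∑ i ∈ s, ‖T (e i)‖ ^ 2 := by rw [Finset.mul_sum]
    _ ≤ (a * c) ^ 2 := by rw [mul_pow]; gcongr; exact h.2 s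

theorem parseval_sq (e : HilbertBasis ι ℝ E) (x : E) :
    HasSum (fun j => (inner ℝ (e j) x) ^ 2) (‖x‖ ^ 2) := by
  have := e.hasSum_inner_mul_inner x x
  rw [real_inner_self_eq_norm_sq] at this
  refine this.congr_fun ?_ |> fun h => h
  intro j
  rw [real_inner_comm x (e j), sq]

theorem HSle.adjoint {e : HilbertBasis ι ℝ E} {T : E →L[ℝ] E} {c : ℝ} (h : HSle e T c) :
    HSle e (ContinuousLinearMap.adjoint T) c := by
  refine ⟨h.1, fun s => ?_⟩
  have hs : HasSum (fun j => ∑ i ∈ s, (inner ℝ (e j) (ContinuousLinearMap.adjoint T (e i))) ^ 2)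
      (∑ i ∈ s, ‖ContinuousLinearMap.adjoint T (e i)‖ ^ 2) :=
    hasSum_sum fun i _ => parseval_sq e _
  refine le_trans (hasSum_le (fun j => ?_) hs h.summable.hasSum) h.tsum_le
  have hb := e.orthonormal.sum_inner_products_le (s := s) (T (e j))
  refine le_trans (le_of_eq ?_) hb
  refine Finset.sum_congr rfl fun i _ => ?_
  rw [ContinuousLinearMap.adjoint_inner_right, real_inner_comm, Real.norm_eq_abs, sq_abs]

theorem HSle.mul_right {e : HilbertBasis ι ℝ E} {T : E →L[ℝ] E} {c a : ℝ} (h : HSle e T c)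
    (A : E →L[ℝ] E) (hA : ‖A‖ ≤ a) : HSle e (T * A) (c * a) := by
  have h1 := (h.adjoint.mul_left (ContinuousLinearMap.adjoint A) (a := a)
    (by simpa using hA)).adjoint
  have h2 : ContinuousLinearMap.adjoint (ContinuousLinearMap.adjoint A *
      ContinuousLinearMap.adjoint T) = T * A := by
    rw [ContinuousLinearMap.mul_def, ContinuousLinearMap.adjoint_comp]
    simp [ContinuousLinearMap.mul_def]
  rw [h2, mul_comm] at h1
  exact h1

theorem HSle.opNorm_le {e : HilbertBasis ι ℝ E} {T : E →L[ℝ] E} {c : ℝ} (h : HSle e T c) :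
    ‖T‖ ≤ c := by
  refine T.opNorm_le_bound h.1 fun x => ?_
  apply le_of_sq_le_sq _ (mul_nonneg h.1 (norm_nonneg x))
  have ha := h.adjoint
  have h1 : HasSum (fun i => ‖ContinuousLinearMap.adjoint T (e i)‖ ^ 2 * ‖x‖ ^ 2)
    ((∑' i, ‖ContinuousLinearMap.adjoint T (e i)‖ ^ 2) * ‖x‖ ^ 2) :=
    ha.summable.hasSum.mul_right _
  refine (hasSum_le (fun j => ?_) (parseval_sq e (T x)) h1).trans ?_
  · rw [← ContinuousLinearMap.adjoint_inner_left, ← mul_pow, ← sq_abs]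
    gcongr
    exact abs_real_inner_le_norm _ _
  · rw [mul_pow]
    gcongr
    exact ha.tsum_le

/-- Facts about the positive square root `Q` of `ε I + D`. -/
theorem root_facts {ε : ℝ} (hε : 0 < ε) {D Q : E →L[ℝ] E} (hD : 0 ≤ D) (hQ_pos : 0 ≤ Q)
    (hQ : Q * Q = ε • (1 : E →L[ℝ] E) + D) :
    IsUnit Q ∧ (∀ x, ‖Q x‖ ^ 2 = ε * ‖x‖ ^ 2 + inner ℝ (D x) x) ∧
      ‖Ring.inverse Q‖ ≤ (Real.sqrt ε)⁻¹ ∧ ∀ x, Real.sqrt ε * ‖x‖ ^ 2 ≤ inner ℝ (Q x) x := by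
  rw [ContinuousLinearMap.nonneg_iff_isPositive] at hD hQ_pos
  have ht : 0 < Real.sqrt ε := Real.sqrt_pos.2 hε
  have htt : Real.sqrt ε ^ 2 = ε := Real.sq_sqrt hε.le
  have hQ2 : ∀ x, inner ℝ ((Q * Q) x) x = ε * ‖x‖ ^ 2 + inner ℝ (D x) x := by
    intro x
    rw [hQ]
    simp [inner_add_left, inner_smul_left]
  have hnorm : ∀ x, ‖Q x‖ ^ 2 = ε * ‖x‖ ^ 2 + inner ℝ (D x) x := by
    intro x
    rw [← hQ2, ← real_inner_self_eq_norm_sq, mulA_apply,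
      hQ_pos.inner_left_eq_inner_right, real_inner_comm]
  have hDx : ∀ x, 0 ≤ inner ℝ (D x) x := fun x => hD.inner_nonneg_left x
  have hunit : IsUnit Q := by
    have h1 : IsUnit (Q * Q) := by
      refine ContinuousLinearMap.isUnit_of_forall_le_norm_inner_map _ (c := ⟨ε, hε.le⟩) hε ?_
      intro x
      rw [hQ2, Real.norm_eq_abs]
      refine le_trans ?_ (le_abs_self _)
      have := hDx x
      change ‖x‖ ^ 2 * ε ≤ _
      linarith
    exact ((Commute.refl Q).isUnit_mul_iff.1 h1).1
  have hQP : ∀ x, Q (Ring.inverse Q x) = x := by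
    intro x
    have := congrArg (fun T : E →L[ℝ] E => T x) (Ring.mul_inverse_cancel Q hunit)
    simpa using this
  have hP : ‖Ring.inverse Q‖ ≤ (Real.sqrt ε)⁻¹ := by
    refine ContinuousLinearMap.opNorm_le_bound _ (by positivity) fun x => ?_
    have h1 := hnorm (Ring.inverse Q x)
    rw [hQP] at h1
    have h2 := hDx (Ring.inverse Q x)
    have h3 : Real.sqrt ε * ‖Ring.inverse Q x‖ ≤ ‖x‖ := by
      apply le_of_sq_le_sq _ (norm_nonneg x)
      rw [mul_pow, htt]
      linarith
    rw [inv_mul_eq_div, le_div_iff₀ ht]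
    linarith
  refine ⟨hunit, hnorm, hP, fun x => ?_⟩
  set t := Real.sqrt ε with ht_def
  set z := Ring.inverse Q x with hz
  have h1 : 0 ≤ inner ℝ (Q (x - t • z)) (x - t • z) := hQ_pos.inner_nonneg_left _
  have hQz : Q z = x := hQP x
  have h2 : inner ℝ (Q x) z = ‖x‖ ^ 2 := by
    have := hQ_pos.inner_left_eq_inner_right x z
    rw [hQz, real_inner_self_eq_norm_sq] at this
    exact this
  have h3 : inner ℝ x z ≤ ‖x‖ * (t⁻¹ * ‖x‖) :=
    (real_inner_le_norm x z).trans
      (mul_le_mul_of_nonneg_left (((Ring.inverse Q).le_opNorm x).trans (by gcongr))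
        (norm_nonneg x))
  have h4 : t * inner ℝ x z ≤ ‖x‖ ^ 2 := by
    calc t * inner ℝ x z ≤ t * (‖x‖ * (t⁻¹ * ‖x‖)) := by gcongr
      _ = ‖x‖ ^ 2 := by field_simp
  have h5 : inner ℝ (Q (x - t • z)) (x - t • z)
      = inner ℝ (Q x) x - 2 * t * ‖x‖ ^ 2 + t * (t * inner ℝ x z) := by
    rw [map_sub, map_smul, hQz, inner_sub_left, inner_sub_right, inner_sub_right,
      inner_smul_left, inner_smul_right, inner_smul_left, inner_smul_right, h2,
      real_inner_self_eq_norm_sq]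
    simp
    ring
  have h6 := mul_le_mul_of_nonneg_left h4 ht.le
  linarith

/-- Operator-norm perturbation bound for square roots bounded below. -/
theorem root_pert {t : ℝ} {Q Q' : E →L[ℝ] E} (ht : 0 ≤ t)
    (hQs : Q.IsPositive) (hQs' : Q'.IsPositive)
    (hQ : ∀ x, t * ‖x‖ ^ 2 ≤ inner ℝ (Q x) x) (hQ' : ∀ x, t * ‖x‖ ^ 2 ≤ inner ℝ (Q' x) x) :
    2 * t * ‖Q - Q'‖ ≤ ‖Q * Q - Q' * Q'‖ := by
  set A := Q - Q' with hA
  set d := ‖Q * Q - Q' * Q'‖ with hd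
  set M := ‖Q + Q'‖ with hM
  by_cases hn0 : ‖A‖ = 0
  · rw [hn0, mul_zero]
    exact norm_nonneg _
  have hn : 0 < ‖A‖ := lt_of_le_of_ne (norm_nonneg _) (Ne.symm hn0)
  set n := ‖A‖ with hn_def
  have hAs : ∀ x y, inner ℝ (A x) y = inner ℝ x (A y) := by
    intro x y
    simp only [hA, sub_apply, inner_sub_left, inner_sub_right]
    rw [hQs.inner_left_eq_inner_right, hQs'.inner_left_eq_inner_right]
  have key : ∀ κ : ℝ, 0 < κ → 2 * t * n ≤ d + M * κ := by
    intro κ hκ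
    have hsup := ContinuousLinearMap.norm_eq_iSup_rayleighQuotient A hAs
    have hlt : n - κ ^ 2 / (2 * n) < ⨆ x, |A.rayleighQuotient x| := by
      rw [← hsup]
      have : 0 < κ ^ 2 / (2 * n) := by positivity
      linarith
    have : Nonempty E := ⟨0⟩
    have hlt' : max (n - κ ^ 2 / (2 * n)) 0 < ⨆ x, |A.rayleighQuotient x| :=
      max_lt hlt (by rw [← hsup]; exact hn)
    obtain ⟨x, hx⟩ := exists_lt_of_lt_ciSup hlt'
    have hx0 : x ≠ 0 := by
      rintro rfl
      have := (le_max_right _ _).trans_lt hx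
      simp at this
    have hxn : 0 < ‖x‖ ^ 2 := by positivity
    have hx1 := (le_max_left _ _).trans_lt hx
    have hray : (n - κ ^ 2 / (2 * n)) * ‖x‖ ^ 2 ≤ |inner ℝ (A x) x| := by
      have h1 : A.rayleighQuotient x = inner ℝ (A x) x / ‖x‖ ^ 2 := by
        simp [ContinuousLinearMap.rayleighQuotient, ContinuousLinearMap.reApplyInnerSelf_apply]
      rw [h1, abs_div, abs_of_pos hxn, lt_div_iff₀ hxn] at hx1
      exact hx1.le
    have hid : ∀ l : ℝ, l * inner ℝ x ((Q + Q') x) =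
        inner ℝ x ((Q * Q - Q' * Q') x) - inner ℝ (A x - l • x) ((Q + Q') x) := by
      intro l
      have e1 : inner ℝ x (Q (Q x)) = inner ℝ (Q x) (Q x) :=
        (hQs.inner_left_eq_inner_right x (Q x)).symm
      have e2 : inner ℝ x (Q' (Q' x)) = inner ℝ (Q' x) (Q' x) :=
        (hQs'.inner_left_eq_inner_right x (Q' x)).symm
      have e3 := real_inner_comm (Q x) (Q' x)
      simp only [hA, sub_apply, add_apply,
        mulA_apply, inner_sub_left, inner_sub_right, inner_add_right,
        real_inner_smul_left, e1, e2]
      linarith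
    have hS1 : 2 * t * ‖x‖ ^ 2 ≤ inner ℝ x ((Q + Q') x) := by
      rw [add_apply, inner_add_right, real_inner_comm, real_inner_comm (Q' x)]
      have := hQ x
      have := hQ' x
      linarith
    have hAx : ‖A x‖ ^ 2 ≤ n ^ 2 * ‖x‖ ^ 2 := by
      rw [← mul_pow]
      gcongr
      exact A.le_opNorm x
    have main : ∀ l : ℝ, |l| = n → l * inner ℝ (A x) x = n * |inner ℝ (A x) x| →
        2 * t * n ≤ d + M * κ := by
      intro l hl hl2
      have hl3 : l ^ 2 = n ^ 2 := by rw [← hl, sq_abs]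
      have hy : ‖A x - l • x‖ ^ 2 ≤ (κ * ‖x‖) ^ 2 := by
        rw [norm_sub_sq_real, inner_smul_right, norm_smul, mul_pow, Real.norm_eq_abs, sq_abs, hl2,
          hl3]
        have h7 := mul_le_mul_of_nonneg_left hray hn.le
        have h8 : n * ((n - κ ^ 2 / (2 * n)) * ‖x‖ ^ 2)
          = n ^ 2 * ‖x‖ ^ 2 - κ ^ 2 * ‖x‖ ^ 2 / 2 := by
          field_simp
        rw [h8] at h7
        nlinarith
      have hy' : ‖A x - l • x‖ ≤ κ * ‖x‖ := le_of_sq_le_sq hy (by positivity)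
      have a1 : |inner ℝ x ((Q * Q - Q' * Q') x)| ≤ d * ‖x‖ ^ 2 := by
        refine (abs_real_inner_le_norm _ _).trans ?_
        have := (Q * Q - Q' * Q').le_opNorm x
        calc _ ≤ ‖x‖ * (d * ‖x‖) := by gcongr
          _ = _ := by ring
      have a2 : |inner ℝ (A x - l • x) ((Q + Q') x)| ≤ M * κ * ‖x‖ ^ 2 := by
        refine (abs_real_inner_le_norm _ _).trans ?_
        have := (Q + Q').le_opNorm x
        calc _ ≤ (κ * ‖x‖) * (M * ‖x‖) := by gcongr
          _ = _ := by ring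
      have a3 : n * inner ℝ x ((Q + Q') x) ≤ (d + M * κ) * ‖x‖ ^ 2 := by
        have hnn : 0 ≤ inner ℝ x ((Q + Q') x) := le_trans (by positivity) hS1
        calc n * inner ℝ x ((Q + Q') x) = |l * inner ℝ x ((Q + Q') x)| := by
              rw [abs_mul, hl, abs_of_nonneg hnn]
          _ ≤ _ := by
              rw [hid l]
              refine (abs_sub _ _).trans ?_
              linarith
      have a4 := mul_le_mul_of_nonneg_left hS1 hn.le
      refine le_of_mul_le_mul_right ?_ hxn
      linarith
    rcases le_total 0 (inner ℝ (A x) x) with h | h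
    · exact main n (abs_of_pos hn) (by rw [abs_of_nonneg h])
    · exact main (-n) (by rw [abs_neg, abs_of_pos hn]) (by rw [abs_of_nonpos h]; ring)
  refine le_of_forall_pos_le_add fun η hη => ?_
  have hM0 : 0 ≤ M := norm_nonneg _
  refine (key (η / (M + 1)) (by positivity)).trans ?_
  have : M * (η / (M + 1)) ≤ η := by
    rw [mul_div_assoc', div_le_iff₀ (by positivity)]
    nlinarith
  linarith

end Helpers


/-- Deterministic bound on the estimation error between the regularized empirical
correlation `R̂₀ := (εI + D̂)^{−1/2} Ĉ₀ (εI + D̂)^{−1/2}` and its oracle counterpart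
`R_{e,0} := (εI + D)^{−1/2} C₀ (εI + D)^{−1/2}`, where `C₀ := D^{1/2} R₀ D^{1/2}`:
if `‖D̂ − D‖₂ ≤ δ` and `‖Ĉ₀ − C₀‖₂ ≤ δ`, then
`‖R̂₀ − R_{e,0}‖₂ ≤ 2 (1 + ‖R₀‖₂)(δ²/ε² + δ/ε)`.
Hilbert–Schmidt norms `‖T‖₂ = (∑ᵢ ‖T eᵢ‖²)^{1/2}` are computed via a Hilbert basis `(eᵢ)`;
`D^{1/2}` is the unique positive square root of `D`, and `(εI + D)^{−1/2}` the ring inverse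
of the unique positive square root of `εI + D` (similarly for `D̂`). -/
theorem stmt_8 {E : Type*} [NormedAddCommGroup E] [InnerProductSpace ℝ E] [CompleteSpace E]
    {ι : Type*} (e : HilbertBasis ι ℝ E)
    (ε δ : ℝ) (hε : 0 < ε) (hδ : 0 ≤ δ)
    (D Dhat : E →L[ℝ] E) (hD : 0 ≤ D) (hDhat : 0 ≤ Dhat)
    (hDD_HS : Summable fun i => ‖(Dhat - D) (e i)‖ ^ 2)
    (hDD : Real.sqrt (∑' i, ‖(Dhat - D) (e i)‖ ^ 2) ≤ δ)
    (R₀ : E →L[ℝ] E) (hR₀_HS : Summable fun i => ‖R₀ (e i)‖ ^ 2)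
    -- `D^{1/2}`: the unique positive square root of `D`
    (sqrtD : E →L[ℝ] E) (hsqrtD_pos : 0 ≤ sqrtD) (hsqrtD : sqrtD * sqrtD = D)
    -- `(εI + D)^{1/2}` and `(εI + D̂)^{1/2}`: unique positive square roots
    (Q : E →L[ℝ] E) (hQ_pos : 0 ≤ Q) (hQ : Q * Q = ε • (1 : E →L[ℝ] E) + D)
    (Qhat : E →L[ℝ] E) (hQhat_pos : 0 ≤ Qhat)
    (hQhat : Qhat * Qhat = ε • (1 : E →L[ℝ] E) + Dhat)
    (Chat₀ : E →L[ℝ] E)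
    (hChat₀_HS : Summable fun i => ‖(Chat₀ - sqrtD * R₀ * sqrtD) (e i)‖ ^ 2)
    (hCC : Real.sqrt (∑' i, ‖(Chat₀ - sqrtD * R₀ * sqrtD) (e i)‖ ^ 2) ≤ δ) :
    Real.sqrt (∑' i,
        ‖(Ring.inverse Qhat * Chat₀ * Ring.inverse Qhat -
            Ring.inverse Q * (sqrtD * R₀ * sqrtD) * Ring.inverse Q) (e i)‖ ^ 2) ≤
      2 * (1 + Real.sqrt (∑' i, ‖R₀ (e i)‖ ^ 2)) * (δ ^ 2 / ε ^ 2 + δ / ε) := by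
  have hQf := root_facts hε hD hQ_pos hQ
  have hQhf := root_facts hε hDhat hQhat_pos hQhat
  obtain ⟨hu, hnorm, hP, hlow⟩ := hQf
  obtain ⟨hu', -, hP', hlow'⟩ := hQhf
  have ht : 0 < Real.sqrt ε := Real.sqrt_pos.2 hε
  have htt : Real.sqrt ε * Real.sqrt ε = ε := Real.mul_self_sqrt hε.le
  have hSD := HSle.of_sqrt hDD_HS hDD
  have hSC := HSle.of_sqrt hChat₀_HS hCC
  have hSR := HSle.of_sqrt hR₀_HS le_rfl
  rw [ContinuousLinearMap.nonneg_iff_isPositive] at hQ_pos hQhat_pos hsqrtD_pos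
  set r := Real.sqrt (∑' i, ‖R₀ (e i)‖ ^ 2) with hr
  have hr0 : 0 ≤ r := Real.sqrt_nonneg _
  set P := Ring.inverse Q with hPdef
  set P' := Ring.inverse Qhat with hPdef'
  set t := Real.sqrt ε with htdef
  have hPQ : P * Q = 1 := Ring.inverse_mul_cancel Q hu
  have hQP : Q * P = 1 := Ring.mul_inverse_cancel Q hu
  have hPQ' : P' * Qhat = 1 := Ring.inverse_mul_cancel Qhat hu'
  have hQP' : Qhat * P' = 1 := Ring.mul_inverse_cancel Qhat hu'
  have hdiff : ‖Q - Qhat‖ ≤ δ / (2 * t) := by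
    have h1 := root_pert ht.le hQ_pos hQhat_pos hlow hlow'
    have h2 : Q * Q - Qhat * Qhat = -(Dhat - D) := by rw [hQ, hQhat]; abel
    rw [h2, norm_neg] at h1
    have h3 := hSD.opNorm_le
    rw [le_div_iff₀ (by positivity)]
    linarith
  have hSP : ‖sqrtD * P‖ ≤ 1 := by
    refine ContinuousLinearMap.opNorm_le_bound _ zero_le_one fun x => ?_
    rw [one_mul]
    apply le_of_sq_le_sq _ (norm_nonneg x)
    have h1 := hnorm (P x)
    have h2 : Q (P x) = x := by
      have := congrArg (fun T : E →L[ℝ] E => T x) hQP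
      simpa using this
    have h3 : inner ℝ (D (P x)) (P x) = ‖sqrtD (P x)‖ ^ 2 := by
      rw [← hsqrtD, mulA_apply, hsqrtD_pos.inner_left_eq_inner_right,
        real_inner_self_eq_norm_sq]
    rw [h2, h3] at h1
    rw [mulA_apply]
    have : 0 ≤ ε * ‖P x‖ ^ 2 := by positivity
    linarith
  have hPstar : star P = P := by
    have hQs : star Q = Q := hQ_pos.isSelfAdjoint
    have h1 : star P * Q = 1 := by
      have := congrArg star hQP
      rwa [star_mul, hQs, star_one] at this
    calc star P = star P * (Q * P) := by rw [hQP, mul_one]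
      _ = P := by rw [← mul_assoc, h1, one_mul]
  have hPS : ‖P * sqrtD‖ ≤ 1 := by
    have hSs : star sqrtD = sqrtD := hsqrtD_pos.isSelfAdjoint
    have : star (sqrtD * P) = P * sqrtD := by rw [star_mul, hPstar, hSs]
    rw [← this, ContinuousLinearMap.star_eq_adjoint]
    exact (LinearIsometryEquiv.norm_map ContinuousLinearMap.adjoint _).le.trans hSP
  have hx : t⁻¹ * (δ / (2 * t)) = δ / (2 * ε) := by
    rw [← htt]; field_simp
  have hd1 : ‖(P' - P) * sqrtD‖ ≤ δ / (2 * ε) := by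
    have h1 : (P' - P) * sqrtD = P' * (Q - Qhat) * (P * sqrtD) := by
      have : P' - P = P' * (Q - Qhat) * P := by
        rw [mul_sub, sub_mul, hPQ', one_mul, mul_assoc, hQP, mul_one]
      rw [this, mul_assoc]
    rw [h1]
    calc _ ≤ ‖P'‖ * ‖Q - Qhat‖ * ‖P * sqrtD‖ :=
          (norm_mul_le _ _).trans (by gcongr; exact norm_mul_le _ _)
      _ ≤ t⁻¹ * (δ / (2 * t)) * 1 := by gcongr
      _ = _ := by rw [mul_one, hx]
  have hd2 : ‖sqrtD * (P' - P)‖ ≤ δ / (2 * ε) := by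
    have h1 : sqrtD * (P' - P) = (sqrtD * P) * ((Q - Qhat) * P') := by
      have : P' - P = P * ((Q - Qhat) * P') := by
        rw [sub_mul, hQP', mul_sub, mul_one, ← mul_assoc, hPQ, one_mul]
      rw [this, mul_assoc sqrtD]
    rw [h1]
    calc _ ≤ ‖sqrtD * P‖ * (‖Q - Qhat‖ * ‖P'‖) :=
          (norm_mul_le _ _).trans (by gcongr; exact norm_mul_le _ _)
      _ ≤ 1 * (δ / (2 * t) * t⁻¹) := by gcongr
      _ = _ := by rw [one_mul, mul_comm, hx]
  have hSP' : ‖sqrtD * P'‖ ≤ 1 + δ / (2 * ε) := by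
    have : sqrtD * P' = sqrtD * P + sqrtD * (P' - P) := by rw [mul_sub]; abel
    rw [this]
    exact (norm_add_le _ _).trans (add_le_add hSP hd2)
  have hdecomp : P' * Chat₀ * P' - P * (sqrtD * R₀ * sqrtD) * P =
      P' * (Chat₀ - sqrtD * R₀ * sqrtD) * P' +
      (((P' - P) * sqrtD) * R₀ * (sqrtD * P') + (P * sqrtD) * R₀ * (sqrtD * (P' - P))) := by
    noncomm_ring
  rw [hdecomp]
  have hA := (hSC.mul_left P' hP').mul_right P' hP'
  have hB := (hSR.mul_left _ hd1).mul_right _ hSP'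
  have hC := (hSR.mul_left _ hPS).mul_right _ hd2
  refine (hA.add (hB.add hC)).sqrt_le.trans ?_
  have e1 : t⁻¹ * δ * t⁻¹ = δ / ε := by rw [← htt]; field_simp
  have e2 : δ / (2 * ε) = δ / ε / 2 := by field_simp
  have e3 : δ ^ 2 / ε ^ 2 = (δ / ε) ^ 2 := by rw [div_pow]
  rw [e1, e2, e3]
  have hx0 : 0 ≤ δ / ε := by positivity
  generalize δ / ε = y at hx0
  have := mul_nonneg hr0 hx0
  have := mul_nonneg hr0 (sq_nonneg y)
  nlinarith [sq_nonneg y]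
end

section
/- Let D be a bounded positive (self-adjoint, nonnegative) operator on a separable real Hilbert space H, let Φ be a Hilbert–Schmidt operator on H, let β > 0 and ε > 0. Set R₀ := D^β Φ D^β and T := (εI + D)^{−1/2} D^{1/2} R₀ D^{1/2} (εI + D)^{−1/2}. Then ‖T − R₀‖₂ ≤ 2 ε^β ‖Φ‖₂ ‖D‖^β if 0 < β ≤ 1, and ‖T − R₀‖₂ ≤ 2 ε ‖Φ‖₂ ‖D‖^{2β−1} if β > 1, where ‖D‖ is the operator norm of D. -/
open scoped InnerProductSpace
open Filter Topology

section Helpers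

set_option linter.unusedSectionVars false

variable {E : Type*} [NormedAddCommGroup E] [InnerProductSpace ℝ E] [CompleteSpace E]

lemma aux_sym {S : E →L[ℝ] E} (h : 0 ≤ S) (x y : E) : ⟪S x, y⟫_ℝ = ⟪x, S y⟫_ℝ :=
  ((ContinuousLinearMap.nonneg_iff_isPositive S).1 h).isSymmetric x y

lemma aux_nn {S : E →L[ℝ] E} (h : 0 ≤ S) (x : E) : 0 ≤ ⟪S x, x⟫_ℝ :=
  ((ContinuousLinearMap.nonneg_iff_isPositive S).1 h).inner_nonneg_left x

lemma aux_dyadic (G : ℝ → E →L[ℝ] E)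
    (hsym : ∀ r, 0 ≤ r → ∀ x y, ⟪G r x, y⟫_ℝ = ⟪x, G r y⟫_ℝ)
    (hadd : ∀ s t, 0 ≤ s → 0 ≤ t → G (s + t) = G s * G t)
    (c M : ℝ) (hc : 0 < c) (hM : 0 ≤ M) (y : E) (N : ℕ)
    (h1 : ∀ k : ℕ, k ≤ N → ‖G k y‖ ≤ c ^ (k : ℝ) * M) (m : ℕ) :
    ∀ k : ℕ, k ≤ N * 2 ^ m → ‖G ((k : ℝ) / 2 ^ m) y‖ ≤ c ^ ((k : ℝ) / 2 ^ m) * M := by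
  have mid : ∀ s t, 0 ≤ s → 0 ≤ t → ‖G s y‖ ≤ c ^ s * M → ‖G t y‖ ≤ c ^ t * M →
      ‖G ((s + t) / 2) y‖ ≤ c ^ ((s + t) / 2) * M := by
    intro s t hs ht h1 h2
    have e1 : ‖G ((s + t) / 2) y‖ ^ 2 = ⟪G s y, G t y⟫_ℝ := by
      rw [← real_inner_self_eq_norm_sq, hsym _ (by positivity), hsym _ hs]
      have a1 := hadd ((s+t)/2) ((s+t)/2) (by positivity) (by positivity)
      have a2 := hadd s t hs ht
      rw [add_halves] at a1
      rw [a1] at a2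
      have := congrArg (fun F : E →L[ℝ] E => F y) a2
      exact congrArg (fun v => ⟪y, v⟫_ℝ) this
    have e2 : ⟪G s y, G t y⟫_ℝ ≤ (c ^ s * M) * (c ^ t * M) :=
      (real_inner_le_norm _ _).trans (mul_le_mul h1 h2 (norm_nonneg _) (by positivity))
    have e3 : (c ^ s * M) * (c ^ t * M) = (c ^ ((s + t) / 2) * M) ^ 2 := by
      have : c ^ s * c ^ t = c ^ ((s + t) / 2) * c ^ ((s + t) / 2) := by
        rw [← Real.rpow_add hc, ← Real.rpow_add hc, add_halves]
      linear_combination M ^ 2 * this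
    rw [← e1, e3] at e2
    exact (pow_le_pow_iff_left₀ (norm_nonneg _) (by positivity) two_ne_zero).1 e2
  induction m with
  | zero => simpa using h1
  | succ m ih =>
    intro k hk
    rcases Nat.even_or_odd' k with ⟨j, rfl | rfl⟩
    · have := ih j (by rw [pow_succ] at hk; lia)
      have e : (((2 * j : ℕ) : ℝ)) / 2 ^ (m + 1) = (j : ℝ) / 2 ^ m := by
        push_cast; rw [pow_succ]; field_simp
      rw [e]; exact this
    · have i1 := ih j (by rw [pow_succ] at hk; lia)
      have i2 := ih (j + 1) (by rw [pow_succ] at hk; lia)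
      have e : (((2 * j + 1 : ℕ) : ℝ)) / 2 ^ (m + 1)
          = ((j : ℝ) / 2 ^ m + ((j + 1 : ℕ) : ℝ) / 2 ^ m) / 2 := by
        push_cast; rw [pow_succ]; field_simp; ring
      rw [e]
      exact mid _ _ (by positivity) (by positivity) i1 i2

lemma aux_interp (G : ℝ → E →L[ℝ] E)
    (hsym : ∀ r, 0 ≤ r → ∀ x y, ⟪G r x, y⟫_ℝ = ⟪x, G r y⟫_ℝ)
    (hadd : ∀ s t, 0 ≤ s → 0 ≤ t → G (s + t) = G s * G t)
    (hcont : ∀ x : E, ContinuousOn (fun r : ℝ => G r x) (Set.Ioi (0 : ℝ)))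
    (c M : ℝ) (hc : 0 < c) (hM : 0 ≤ M) (y : E) (N : ℕ)
    (h1 : ∀ k : ℕ, k ≤ N → ‖G k y‖ ≤ c ^ (k : ℝ) * M) (r : ℝ) (hr : 0 < r) (hrN : r ≤ N) :
    ‖G r y‖ ≤ c ^ r * M := by
  have hd := aux_dyadic G hsym hadd c M hc hM y N h1
  have hpow : Tendsto (fun m : ℕ => (2 : ℝ) ^ m) atTop atTop :=
    tendsto_pow_atTop_atTop_of_one_lt (by norm_num)
  have ht : Tendsto (fun m : ℕ => ((⌊r * 2 ^ m⌋₊ : ℕ) : ℝ) / 2 ^ m) atTop (𝓝 r) :=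
    (tendsto_nat_floor_mul_div_atTop hr.le).comp hpow
  have c1 : ContinuousAt (fun r : ℝ => ‖G r y‖) r :=
    ((hcont y).continuousAt (Ioi_mem_nhds hr)).norm
  have c2 : ContinuousAt (fun r : ℝ => c ^ r * M) r :=
    (Real.continuousAt_const_rpow hc.ne').mul continuousAt_const
  refine le_of_tendsto_of_tendsto (c1.tendsto.comp ht) (c2.tendsto.comp ht)
    (Eventually.of_forall fun m => ?_)
  refine hd m _ ?_
  have : ((⌊r * 2 ^ m⌋₊ : ℕ) : ℝ) ≤ (N * 2 ^ m : ℕ) := by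
    refine (Nat.floor_le (by positivity)).trans ?_
    push_cast; gcongr
  exact_mod_cast this

/-- Sylvester argument. -/
lemma aux_comm (Q S : E →L[ℝ] E) (hQ : 0 ≤ Q) (ε : ℝ) (hε : 0 < ε)
    (hlow : ∀ x, ε * ‖x‖ ^ 2 ≤ ‖Q x‖ ^ 2) (h : Commute S (Q * Q)) : Commute S Q := by
  set M : ℝ := ‖Q‖ + 1 with hM
  have hMpos : 0 < M := by positivity
  have cs : ∀ x, ‖Q x‖ ^ 2 ≤ M * ⟪Q x, x⟫_ℝ := by
    intro x
    have h0 := aux_nn hQ (M • x - Q x)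
    have hs := aux_sym hQ (Q x) x
    have e : ⟪Q (M • x - Q x), M • x - Q x⟫_ℝ
        = M ^ 2 * ⟪Q x, x⟫_ℝ - 2 * M * ‖Q x‖ ^ 2 + ⟪Q (Q x), Q x⟫_ℝ := by
      simp only [map_sub, map_smul, inner_sub_left, inner_sub_right, real_inner_smul_left,
        real_inner_smul_right, hs, real_inner_self_eq_norm_sq]
      ring
    have b : ⟪Q (Q x), Q x⟫_ℝ ≤ M * ‖Q x‖ ^ 2 := by
      refine (real_inner_le_norm _ _).trans ?_
      have := Q.le_opNorm (Q x)
      have : ‖Q (Q x)‖ ≤ M * ‖Q x‖ := this.trans (by gcongr; linarith)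
      nlinarith [norm_nonneg (Q x)]
    rw [e] at h0
    have : 0 ≤ M * (M * ⟪Q x, x⟫_ℝ - ‖Q x‖ ^ 2) := by linarith
    linarith [nonneg_of_mul_nonneg_right this hMpos]
  set K : ℝ := max (M ^ 2 - ε) 0
  have hK : √K < M := by
    rw [Real.sqrt_lt' hMpos]
    exact max_lt (by linarith) (by positivity)
  set W : E →L[ℝ] E := M • 1 - Q with hW
  have hWn : ‖W‖ ≤ √K := by
    refine ContinuousLinearMap.opNorm_le_bound _ (Real.sqrt_nonneg _) fun x => ?_
    rw [← pow_le_pow_iff_left₀ (norm_nonneg _) (by positivity) two_ne_zero, mul_pow,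
      Real.sq_sqrt (le_max_right _ _)]
    have e : ‖W x‖ ^ 2 = M ^ 2 * ‖x‖ ^ 2 - 2 * M * ⟪Q x, x⟫_ℝ + ‖Q x‖ ^ 2 := by
      have : W x = M • x - Q x := by simp [hW]
      rw [this, norm_sub_sq_real, norm_smul, real_inner_smul_left, real_inner_comm, mul_pow]
      simp; ring
    have : M ^ 2 - ε ≤ K := le_max_left _ _
    nlinarith [cs x, hlow x, sq_nonneg ‖x‖]
  have hC : S * Q - Q * S = 0 := by
    set C := S * Q - Q * S with hCdef
    have e1 : Q * C + C * Q = 0 := by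
      have := h.eq
      rw [hCdef]
      calc _ = S * (Q * Q) - Q * Q * S := by noncomm_ring
        _ = 0 := by rw [this, sub_self]
    have e2 : (2 * M) • C = W * C + C * W := by
      have : W * C + C * W = (2 * M) • C - (Q * C + C * Q) := by
        rw [hW]; simp only [sub_mul, mul_sub, smul_mul_assoc, mul_smul_comm, one_mul, mul_one]
        module
      rw [this, e1, sub_zero]
    have e3 : 2 * M * ‖C‖ ≤ 2 * √K * ‖C‖ := by
      calc 2 * M * ‖C‖ = ‖(2 * M) • C‖ := by
            rw [norm_smul, Real.norm_of_nonneg (by positivity)]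
        _ ≤ ‖W * C‖ + ‖C * W‖ := by rw [e2]; exact norm_add_le _ _
        _ ≤ ‖W‖ * ‖C‖ + ‖C‖ * ‖W‖ := add_le_add (norm_mul_le _ _) (norm_mul_le _ _)
        _ ≤ 2 * √K * ‖C‖ := by nlinarith [norm_nonneg C]
    rw [← norm_eq_zero]
    nlinarith [norm_nonneg C]
  exact sub_eq_zero.1 hC

/-- Squared Hilbert-Schmidt norm, extended valued. -/
noncomputable def auxHS {ι : Type*} (e : HilbertBasis ι ℝ E) (Z : E →L[ℝ] E) : ENNReal :=
  ∑' i, ENNReal.ofReal (‖Z (e i)‖ ^ 2)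

lemma auxHS_adjoint {ι : Type*} (e : HilbertBasis ι ℝ E) (Z : E →L[ℝ] E) :
    auxHS e Z = auxHS e (ContinuousLinearMap.adjoint Z) := by
  have key : ∀ x : E, ENNReal.ofReal (‖x‖ ^ 2) = ∑' j, ENNReal.ofReal (⟪x, e j⟫_ℝ ^ 2) := by
    intro x
    have h := e.hasSum_inner_mul_inner x x
    have h' : HasSum (fun j => ⟪x, e j⟫_ℝ ^ 2) (‖x‖ ^ 2) := by
      rw [real_inner_self_eq_norm_sq] at h
      refine h.congr_fun ?_ |> id
      intro j
      rw [real_inner_comm x (e j), sq]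
    rw [← h'.tsum_eq, ENNReal.ofReal_tsum_of_nonneg (fun _ => sq_nonneg _) h'.summable]
  unfold auxHS
  simp_rw [key]
  rw [ENNReal.tsum_comm]
  refine tsum_congr fun i => tsum_congr fun j => ?_
  rw [ContinuousLinearMap.adjoint_inner_left, real_inner_comm]

lemma auxHS_mul_left {ι : Type*} (e : HilbertBasis ι ℝ E) (X Z : E →L[ℝ] E) (a : ℝ)
    (ha : ‖X‖ ≤ a) : auxHS e (X * Z) ≤ ENNReal.ofReal (a ^ 2) * auxHS e Z := by
  unfold auxHS
  rw [← ENNReal.tsum_mul_left]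
  refine ENNReal.tsum_le_tsum fun i => ?_
  rw [← ENNReal.ofReal_mul (sq_nonneg _), ← mul_pow]
  refine ENNReal.ofReal_le_ofReal ?_
  have : ‖(X * Z) (e i)‖ ≤ a * ‖Z (e i)‖ :=
    (X.le_opNorm (Z (e i))).trans (by gcongr)
  gcongr

lemma auxHS_mul_right {ι : Type*} (e : HilbertBasis ι ℝ E) (X Z : E →L[ℝ] E) (a : ℝ)
    (ha : ‖X‖ ≤ a) : auxHS e (Z * X) ≤ ENNReal.ofReal (a ^ 2) * auxHS e Z := by
  rw [auxHS_adjoint e (Z * X), auxHS_adjoint e Z]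
  have : ContinuousLinearMap.adjoint (Z * X)
      = ContinuousLinearMap.adjoint X * ContinuousLinearMap.adjoint Z :=
    ContinuousLinearMap.adjoint_comp Z X
  rw [this]
  exact auxHS_mul_left e _ _ a (by rwa [LinearIsometryEquiv.norm_map])

lemma auxHS_add {ι : Type*} (e : HilbertBasis ι ℝ E) (X Z : E →L[ℝ] E) :
    auxHS e (X + Z) ≤ 2 * (auxHS e X + auxHS e Z) := by
  unfold auxHS
  rw [← ENNReal.tsum_add, ← ENNReal.tsum_mul_left]
  refine ENNReal.tsum_le_tsum fun i => ?_
  rw [← ENNReal.ofReal_add (sq_nonneg _) (sq_nonneg _),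
    ← ENNReal.ofReal_ofNat 2, ← ENNReal.ofReal_mul (by norm_num)]
  refine ENNReal.ofReal_le_ofReal ?_
  have : ‖(X + Z) (e i)‖ ≤ ‖X (e i)‖ + ‖Z (e i)‖ := norm_add_le _ _
  nlinarith [sq_nonneg (‖X (e i)‖ - ‖Z (e i)‖), norm_nonneg ((X + Z) (e i))]

lemma aux_final {ι : Type*} (e : HilbertBasis ι ℝ E) (Φ U B : E →L[ℝ] E)
    (hΦ_HS : Summable fun i => ‖Φ (e i)‖ ^ 2) (κ b : ℝ) (hκ : 0 ≤ κ) (hb : 0 ≤ b)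
    (h1 : ‖U - B‖ ≤ κ) (h2 : ‖U‖ ≤ b) (h3 : ‖B‖ ≤ b) :
    Real.sqrt (∑' i, ‖(U * Φ * U - B * Φ * B) (e i)‖ ^ 2) ≤
      2 * κ * Real.sqrt (∑' i, ‖Φ (e i)‖ ^ 2) * b := by
  have hS : auxHS e Φ = ENNReal.ofReal (∑' i, ‖Φ (e i)‖ ^ 2) :=
    (ENNReal.ofReal_tsum_of_nonneg (fun _ => sq_nonneg _) hΦ_HS).symm
  set S := ∑' i, ‖Φ (e i)‖ ^ 2 with hSdef
  have hS0 : 0 ≤ S := tsum_nonneg fun _ => sq_nonneg _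
  have dec : U * Φ * U - B * Φ * B = (U - B) * (Φ * U) + B * (Φ * (U - B)) := by noncomm_ring
  have b1 : auxHS e ((U - B) * (Φ * U)) ≤ ENNReal.ofReal (κ ^ 2 * (b ^ 2 * S)) := by
    rw [ENNReal.ofReal_mul (sq_nonneg _), ENNReal.ofReal_mul (sq_nonneg _), ← hS]
    exact (auxHS_mul_left e _ _ κ h1).trans (by gcongr; exact auxHS_mul_right e _ _ b h2)
  have b2 : auxHS e (B * (Φ * (U - B))) ≤ ENNReal.ofReal (κ ^ 2 * (b ^ 2 * S)) := by
    rw [mul_left_comm, ENNReal.ofReal_mul (sq_nonneg _), ENNReal.ofReal_mul (sq_nonneg _), ← hS]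
    exact (auxHS_mul_left e _ _ b h3).trans (by gcongr; exact auxHS_mul_right e _ _ κ h1)
  have tot : auxHS e (U * Φ * U - B * Φ * B) ≤ ENNReal.ofReal ((2 * κ * √S * b) ^ 2) := by
    rw [dec]
    refine (auxHS_add e _ _).trans ?_
    refine (mul_le_mul_right (add_le_add b1 b2) 2).trans_eq ?_
    rw [← ENNReal.ofReal_add (by positivity) (by positivity),
      ← ENNReal.ofReal_ofNat 2, ← ENNReal.ofReal_mul (by norm_num)]
    congr 1
    rw [mul_pow, mul_pow, Real.sq_sqrt hS0]; ring
  refine Real.sqrt_le_iff.2 ⟨by positivity, ?_⟩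
  have : ∑' i, ‖(U * Φ * U - B * Φ * B) (e i)‖ ^ 2
      = (auxHS e (U * Φ * U - B * Φ * B)).toReal := by
    unfold auxHS
    rw [ENNReal.tsum_toReal_eq (fun _ => ENNReal.ofReal_ne_top)]
    exact tsum_congr fun i => (ENNReal.toReal_ofReal (sq_nonneg _)).symm
  rw [this]
  exact ENNReal.toReal_le_of_le_ofReal (by positivity) tot

end Helpers


/-- Approximation error of the `ε`-regularized correlation: with `D` a bounded positive
operator, `Φ` Hilbert–Schmidt, `β > 0`, `R₀ := D^β Φ D^β` and
`T := (εI + D)^{−1/2} D^{1/2} R₀ D^{1/2} (εI + D)^{−1/2}`, one has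
`‖T − R₀‖₂ ≤ 2 ε^β ‖Φ‖₂ ‖D‖^β` if `β ≤ 1` and `‖T − R₀‖₂ ≤ 2 ε ‖Φ‖₂ ‖D‖^{2β−1}` if `β > 1`.
The powers `D^r` (for `r > 0`) are given by the continuous functional calculus; they are
characterized here by the defining properties of the positive power semigroup
`Dpow : r ↦ D^r` (positivity, semigroup law, `D^1 = D`, strong continuity on `(0,∞)`).
`(εI + D)^{−1/2}` is the ring inverse of the unique positive square root `Q` of `εI + D`.
Hilbert–Schmidt norms are computed through a Hilbert basis `(eᵢ)`; `‖D‖` is the operator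
norm. -/
theorem stmt_10 {E : Type*} [NormedAddCommGroup E] [InnerProductSpace ℝ E] [CompleteSpace E]
    {ι : Type*} (e : HilbertBasis ι ℝ E)
    (D : E →L[ℝ] E) (hD : 0 ≤ D)
    (Φ : E →L[ℝ] E) (hΦ_HS : Summable fun i => ‖Φ (e i)‖ ^ 2)
    (β ε : ℝ) (hβ : 0 < β) (hε : 0 < ε)
    -- the power semigroup `r ↦ D^r` for `r > 0`, i.e. the continuous functional calculus
    (Dpow : ℝ → E →L[ℝ] E)
    (hDpow_pos : ∀ r, 0 < r → 0 ≤ Dpow r)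
    (hDpow_add : ∀ s t, 0 < s → 0 < t → Dpow (s + t) = Dpow s * Dpow t)
    (hDpow_one : Dpow 1 = D)
    (hDpow_cont : ∀ x : E, ContinuousOn (fun r : ℝ => Dpow r x) (Set.Ioi (0 : ℝ)))
    -- `(εI + D)^{1/2}`: the unique positive square root of `εI + D`
    (Q : E →L[ℝ] E) (hQ_pos : 0 ≤ Q) (hQ : Q * Q = ε • (1 : E →L[ℝ] E) + D) :
    (β ≤ 1 →
      Real.sqrt (∑' i,
          ‖(Ring.inverse Q * (Dpow (1 / 2) * (Dpow β * Φ * Dpow β) * Dpow (1 / 2)) *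
              Ring.inverse Q - Dpow β * Φ * Dpow β) (e i)‖ ^ 2) ≤
        2 * ε ^ β * Real.sqrt (∑' i, ‖Φ (e i)‖ ^ 2) * ‖D‖ ^ β) ∧
    (1 < β →
      Real.sqrt (∑' i,
          ‖(Ring.inverse Q * (Dpow (1 / 2) * (Dpow β * Φ * Dpow β) * Dpow (1 / 2)) *
              Ring.inverse Q - Dpow β * Φ * Dpow β) (e i)‖ ^ 2) ≤
        2 * ε * Real.sqrt (∑' i, ‖Φ (e i)‖ ^ 2) * ‖D‖ ^ (2 * β - 1)) := by
  have hQ2 : ∀ x, Q (Q x) = ε • x + D x := fun x => by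
    simpa using congrArg (fun F : E →L[ℝ] E => F x) hQ
  have hlow : ∀ x, ε * ‖x‖ ^ 2 ≤ ‖Q x‖ ^ 2 := fun x => by
    rw [← real_inner_self_eq_norm_sq (Q x), ← aux_sym hQ_pos, hQ2, inner_add_left,
      real_inner_smul_left, real_inner_self_eq_norm_sq]
    linarith [aux_nn hD x]
  -- invertibility
  have hQQu : IsUnit (Q * Q) := by
    refine ContinuousLinearMap.isUnit_of_forall_le_norm_inner_map (𝕜 := ℝ) _ (c := ⟨ε, hε.le⟩) hε
      fun x => ?_
    refine le_trans ?_ (le_abs_self _)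
    show ‖x‖ ^ 2 * ε ≤ ⟪Q (Q x), x⟫_ℝ
    rw [hQ2, inner_add_left, real_inner_smul_left, real_inner_self_eq_norm_sq]
    linarith [aux_nn hD x]
  have hQu : IsUnit Q := ((Commute.refl Q).isUnit_mul_iff.1 hQQu).1
  set J := Ring.inverse Q with hJ
  have hJQ : J * Q = 1 := Ring.inverse_mul_cancel _ hQu
  have hQJ : Q * J = 1 := Ring.mul_inverse_cancel _ hQu
  -- commutation
  have cDD : ∀ s t, 0 < s → 0 < t → Commute (Dpow s) (Dpow t) := fun s t hs ht => by
    show Dpow s * Dpow t = Dpow t * Dpow s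
    rw [← hDpow_add s t hs ht, ← hDpow_add t s ht hs, add_comm]
  have cQ : ∀ s, 0 < s → Commute (Dpow s) Q := fun s hs => by
    refine aux_comm Q _ hQ_pos ε hε hlow ?_
    rw [hQ, ← hDpow_one]
    exact ((Commute.one_right _).smul_right ε).add_right (cDD s 1 hs one_pos)
  have cJ : ∀ s, 0 < s → Commute (Dpow s) J := fun s hs => by
    show Dpow s * J = J * Dpow s
    calc Dpow s * J = J * (Q * Dpow s) * J := by rw [← mul_assoc, hJQ, one_mul]
      _ = J * (Dpow s * Q) * J := by rw [(cQ s hs).eq]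
      _ = J * Dpow s := by rw [mul_assoc, mul_assoc, hQJ, mul_one]
  -- the extended semigroup
  set G : ℝ → E →L[ℝ] E := fun r => if r = 0 then 1 else Dpow r with hG
  have G0 : G 0 = 1 := by simp [hG]
  have Gp : ∀ r, 0 < r → G r = Dpow r := fun r hr => by simp [hG, hr.ne']
  have Gsym : ∀ r, 0 ≤ r → ∀ x y, ⟪G r x, y⟫_ℝ = ⟪x, G r y⟫_ℝ := by
    intro r hr x y
    rcases hr.eq_or_lt with rfl | hr
    · simp [G0]
    · rw [Gp r hr]; exact aux_sym (hDpow_pos r hr) x y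
  have Gadd : ∀ s t, 0 ≤ s → 0 ≤ t → G (s + t) = G s * G t := by
    intro s t hs ht
    rcases hs.eq_or_lt with rfl | hs
    · simp [G0]
    rcases ht.eq_or_lt with rfl | ht
    · simp [G0]
    rw [Gp _ hs, Gp _ ht, Gp _ (by positivity), hDpow_add s t hs ht]
  have Gcont : ∀ x : E, ContinuousOn (fun r : ℝ => G r x) (Set.Ioi (0 : ℝ)) := fun x =>
    (hDpow_cont x).congr fun r hr => by simp only [Gp r hr]
  have G1 : G 1 = D := by rw [Gp 1 one_pos, hDpow_one]
  -- norm bound of powers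
  have hnorm : ∀ r, 0 < r → ∀ y, ‖Dpow r y‖ ≤ ‖D‖ ^ r * ‖y‖ := by
    intro r hr y
    have step : ∀ c, ‖D‖ < c → ‖Dpow r y‖ ≤ c ^ r * ‖y‖ := by
      intro c hc
      have hc0 : 0 < c := (norm_nonneg D).trans_lt hc
      rw [← Gp r hr]
      refine aux_interp G Gsym Gadd Gcont c ‖y‖ hc0 (norm_nonneg _) y ⌈r⌉₊ ?_ r hr (Nat.le_ceil r)
      intro k _
      induction k with
      | zero => simp [G0]
      | succ k ih =>
        have : G ((k + 1 : ℕ) : ℝ) y = D (G k y) := by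
          rw [← G1]; push_cast; rw [add_comm, Gadd 1 k zero_le_one (by positivity)]; rfl
        rw [this]
        refine (D.le_opNorm _).trans ?_
        calc ‖D‖ * ‖G k y‖ ≤ c * (c ^ (k : ℝ) * ‖y‖) := by
              gcongr
              exact ih (by lia)
          _ = _ := by push_cast; rw [Real.rpow_add hc0, Real.rpow_one]; ring
    have hct : Tendsto (fun c : ℝ => c ^ r * ‖y‖) (𝓝[>] ‖D‖) (𝓝 (‖D‖ ^ r * ‖y‖)) :=
      (((Real.continuousAt_rpow_const _ _ (Or.inr hr.le)).mul
        continuousAt_const).tendsto).mono_left nhdsWithin_le_nhds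
    exact ge_of_tendsto hct (eventually_nhdsWithin_of_forall fun c hc => step c hc)
  -- bounds for ε + D
  have hexp : ∀ u, ‖ε • u + D u‖ ^ 2 = ε ^ 2 * ‖u‖ ^ 2 + 2 * ε * ⟪D u, u⟫_ℝ + ‖D u‖ ^ 2 := by
    intro u
    rw [norm_add_sq_real, norm_smul, real_inner_smul_left, real_inner_comm, mul_pow]
    simp; ring
  have hb1 : ∀ u, ε * ‖u‖ ≤ ‖ε • u + D u‖ := fun u => by
    rw [← pow_le_pow_iff_left₀ (by positivity) (norm_nonneg _) two_ne_zero, hexp]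
    nlinarith [mul_nonneg hε.le (aux_nn hD u), sq_nonneg ‖D u‖]
  have hb2 : ∀ u, ‖D u‖ ≤ ‖ε • u + D u‖ := fun u => by
    rw [← pow_le_pow_iff_left₀ (by positivity) (norm_nonneg _) two_ne_zero, hexp]
    nlinarith [mul_nonneg hε.le (aux_nn hD u), sq_nonneg (ε * ‖u‖)]
  -- the operator A
  have hh : (0 : ℝ) < 1 / 2 := by norm_num
  have hq : (0 : ℝ) < 1 / 4 := by norm_num
  set P := Dpow (1 / 2) with hP
  set B := Dpow β with hB
  have hPP : P * P = D := by
    rw [hP, ← hDpow_add _ _ hh hh, add_halves, hDpow_one]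
  set A := J * P with hA
  have hAcomm : A = P * J := (cJ _ hh).eq.symm
  have hAB : Commute A B := ((cJ β hβ).symm).mul_left (cDD _ _ hh hβ)
  have hJsym : ∀ x y, ⟪J x, y⟫_ℝ = ⟪x, J y⟫_ℝ := by
    intro x y
    have q : ∀ z, Q (J z) = z := fun z => congrArg (fun F : E →L[ℝ] E => F z) hQJ
    conv_lhs => rw [← q y]
    rw [← aux_sym hQ_pos, q]
  have hJnn : ∀ x, 0 ≤ ⟪J x, x⟫_ℝ := by
    intro x
    have q : ∀ z, Q (J z) = z := fun z => congrArg (fun F : E →L[ℝ] E => F z) hQJ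
    have := aux_nn hQ_pos (J x)
    rwa [q, real_inner_comm] at this
  have hAnn : ∀ x, 0 ≤ ⟪A x, x⟫_ℝ := by
    intro x
    have e1 : A = Dpow (1 / 4) * (J * Dpow (1 / 4)) := by
      rw [← mul_assoc, (cJ _ hq).eq, mul_assoc, ← hDpow_add _ _ hq hq, hA, hP]; norm_num
    rw [e1]
    show 0 ≤ ⟪Dpow (1 / 4) (J (Dpow (1 / 4) x)), x⟫_ℝ
    rw [aux_sym (hDpow_pos _ hq)]
    exact hJnn _
  have hAle : ∀ x, ‖A x‖ ≤ ‖x‖ := by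
    intro x
    have q : Q (J x) = x := congrArg (fun F : E →L[ℝ] E => F x) hQJ
    have e1 : A x = P (J x) := by rw [hAcomm]; rfl
    have p : ∀ z, P (P z) = D z := fun z => congrArg (fun F : E →L[ℝ] E => F z) hPP
    rw [e1]
    conv_rhs => rw [← q]
    rw [← pow_le_pow_iff_left₀ (norm_nonneg _) (norm_nonneg _) two_ne_zero,
      ← real_inner_self_eq_norm_sq (P (J x)), ← real_inner_self_eq_norm_sq (Q (J x)),
      ← aux_sym hQ_pos, hQ2, ← aux_sym (hDpow_pos _ hh), p, inner_add_left, real_inner_smul_left,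
      real_inner_self_eq_norm_sq]
    have : 0 ≤ ε * ‖J x‖ ^ 2 := by positivity
    linarith
  have hA2 : (1 + A) * (1 - A) = ε • (J * J) := by
    have e1 : A * A = J * J * D := by
      rw [← hPP, hA]
      calc J * P * (J * P) = J * (P * J) * P := by noncomm_ring
        _ = J * (J * P) * P := by rw [(cJ _ hh).eq]
        _ = _ := by noncomm_ring
    have e2 : J * J * (ε • 1 + D) = 1 := by
      rw [← hQ]
      calc J * J * (Q * Q) = J * (J * Q) * Q := by noncomm_ring
        _ = 1 := by rw [hJQ, mul_one, hJQ]
    have e3 : (1 + A) * (1 - A) = 1 - A * A := by noncomm_ring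
    rw [e3, e1]
    nth_rewrite 1 [← e2]
    rw [mul_add, mul_smul_comm, mul_one, add_sub_cancel_right]
  have hV : ∀ y, ‖(A * B - B) y‖ ≤ ε * ‖B (J (J y))‖ := by
    intro y
    set z := (1 - A) (B y) with hz
    have z1 : ‖(A * B - B) y‖ = ‖z‖ := by
      rw [← norm_neg]; congr 1; simp [hz]
    have z2 : ‖z‖ ≤ ‖(1 + A) z‖ := by
      have : (1 + A) z = z + A z := by simp
      rw [← pow_le_pow_iff_left₀ (norm_nonneg _) (norm_nonneg _) two_ne_zero, this,
        norm_add_sq_real, real_inner_comm]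
      nlinarith [hAnn z, sq_nonneg ‖A z‖]
    have z3 : (1 + A) z = ε • B (J (J y)) := by
      have e1 : (1 + A) z = ((1 + A) * (1 - A) * B) y := rfl
      rw [e1, hA2, smul_mul_assoc, ← ((cJ β hβ).mul_right (cJ β hβ)).eq]; rfl
    rw [z1]
    refine z2.trans_eq ?_
    rw [z3, norm_smul, Real.norm_of_nonneg hε.le]
  have hy : ∀ y, ε • J (J y) + D (J (J y)) = y := by
    intro y
    have q : ∀ z, Q (J z) = z := fun z => congrArg (fun F : E →L[ℝ] E => F z) hQJ
    rw [← hQ2, q, q]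
  have hBn : ‖B‖ ≤ ‖D‖ ^ β :=
    ContinuousLinearMap.opNorm_le_bound _ (by positivity) (hnorm β hβ)
  have hUn : ‖A * B‖ ≤ ‖D‖ ^ β :=
    ContinuousLinearMap.opNorm_le_bound _ (by positivity) fun x =>
      (hAle (B x)).trans (hnorm β hβ x)
  have hT : J * (P * (B * Φ * B) * P) * J = (A * B) * Φ * (A * B) := by
    calc J * (P * (B * Φ * B) * P) * J = (J * P) * B * Φ * (B * (P * J)) := by noncomm_ring
      _ = _ := by rw [← hAcomm, ← hA, hAB.eq]
  rw [hT]
  constructor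
  · intro hβ1
    refine aux_final e Φ (A * B) B hΦ_HS (ε ^ β) (‖D‖ ^ β) (by positivity) (by positivity) ?_ hUn hBn
    refine ContinuousLinearMap.opNorm_le_bound _ (by positivity) fun y => (hV y).trans ?_
    set u := J (J y) with hu
    have hyu := hy y
    have := aux_interp G Gsym Gadd Gcont ε (‖y‖ / ε) hε (by positivity) u 1 ?_ β hβ (by simpa)
    · rw [Gp β hβ] at this
      calc ε * ‖B u‖ ≤ ε * (ε ^ β * (‖y‖ / ε)) := by gcongr
        _ = _ := by field_simp
    · intro k hk
      interval_cases k
      · have := hb1 u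
        rw [hyu] at this
        simp only [Nat.cast_zero, G0, Real.rpow_zero, one_mul]
        rw [le_div_iff₀ hε]
        simpa [mul_comm] using this
      · have := hb2 u
        rw [hyu] at this
        simp only [Nat.cast_one, G1, Real.rpow_one]
        rwa [mul_div_cancel₀ _ hε.ne']
  · intro hβ1
    have hp : 0 < β - 1 := by linarith
    have main := aux_final e Φ (A * B) B hΦ_HS (ε * ‖D‖ ^ (β - 1)) (‖D‖ ^ β)
      (by positivity) (by positivity) ?_ hUn hBn
    · refine main.trans_eq ?_
      have : ‖D‖ ^ (2 * β - 1) = ‖D‖ ^ (β - 1) * ‖D‖ ^ β := by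
        rw [← Real.rpow_add_of_nonneg (norm_nonneg _) hp.le hβ.le]; congr 1; ring
      rw [this]; ring
    refine ContinuousLinearMap.opNorm_le_bound _ (by positivity) fun y => (hV y).trans ?_
    have e1 : B = Dpow (β - 1) * D := by
      rw [hB, ← hDpow_one, ← hDpow_add _ _ hp one_pos, sub_add_cancel]
    have e2 : ‖B (J (J y))‖ ≤ ‖D‖ ^ (β - 1) * ‖y‖ := by
      rw [e1]
      refine (hnorm _ hp (D (J (J y)))).trans ?_
      have := hb2 (J (J y))
      rw [hy] at this
      gcongr
    rw [mul_assoc]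
    gcongr
end
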